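/- Let D = {t_1 < t_2 < … < t_n} be a labeled ordered finite instance in dom^d with FD set Σ, let k ≥ 1, and assume that every repair of D w.r.t. Σ has at least k tuples and that in some repair the k-NN classifier assigns a label ℓ0 to the test point. Then the test point is NOT certifiably robust with respect to the repairs of D if and only if there exist a label ℓ ≠ ℓ0, a repair K of D w.r.t. Σ, and a threshold τ ∈ {1,…,n} such that |{t_j ∈ K : j ≤ τ}| = k and |{t_j ∈ K : j ≤ τ and L(t_j) = ℓ}| ≥ |{t_j ∈ K : j ≤ τ and L(t_j) = ℓ0}|. -/

import Mathlib

/-- A set `I` of tuples satisfies the FD `fd = (X, B)` if any two tuples of `I`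
agreeing on every attribute of `X` also agree on every attribute of `B`. -/
def SatFD {d : ℕ} {dom : Type*} (I : Finset (Fin d → dom))
    (fd : Set (Fin d) × Set (Fin d)) : Prop :=
  ∀ s ∈ I, ∀ t ∈ I, (∀ a ∈ fd.1, s a = t a) → ∀ b ∈ fd.2, s b = t b

/-- `I` satisfies every FD of the FD set `FDs`. -/
def SatFDs {d : ℕ} {dom : Type*} (I : Finset (Fin d → dom))
    (FDs : Set (Set (Fin d) × Set (Fin d))) : Prop :=
  ∀ fd ∈ FDs, SatFD I fd

/-- `I` is a repair of `D` w.r.t. `FDs`: a subset of `D` satisfying `FDs` that is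
maximal under inclusion among the subsets of `D` satisfying `FDs`. -/
def IsFDRepair {d : ℕ} {dom : Type*} (FDs : Set (Set (Fin d) × Set (Fin d)))
    (D I : Finset (Fin d → dom)) : Prop :=
  I ⊆ D ∧ SatFDs I FDs ∧ ∀ J : Finset (Fin d → dom), I ⊆ J → J ⊆ D → SatFDs J FDs → J = I

/-- The k-neighborhood: the set of the `k` smallest elements of `I` under `<`. -/
def nbhd {T : Type*} [LinearOrder T] (k : ℕ) (I : Finset T) : Finset T :=
  I.filter fun t => (I.filter fun s => s < t).card < k

/-- `labCount L k ℓ I = C(ℓ, I)`: the number of elements of the `k`-neighborhood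
of `I` carrying label `ℓ`. -/
def labCount {T Y : Type*} [LinearOrder T] [DecidableEq Y]
    (L : T → Y) (k : ℕ) (ℓ : Y) (I : Finset T) : ℕ :=
  ((nbhd k I).filter fun t => L t = ℓ).card

/-- A lower segment of `K` with exactly `k` elements is the `k`-neighborhood of `K`. -/
theorem nbhd_eq_filter_le {T : Type*} [LinearOrder T] {k : ℕ} {K : Finset T} {t : T}
    (ht : (K.filter fun s => s ≤ t).card = k) : nbhd k K = K.filter fun s => s ≤ t := by
  refine Finset.filter_congr fun s hs => ⟨fun hlt => ?_, fun hst => ?_⟩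
  · by_contra! hts
    refine hlt.not_ge (ht ▸ Finset.card_le_card ?_)
    exact Finset.monotone_filter_right K fun u _ hu => lt_of_le_of_lt hu hts
  · rw [← ht]
    refine Finset.card_lt_card (Finset.ssubset_iff_of_subset ?_ |>.mpr ⟨s, ?_, ?_⟩)
    · exact Finset.monotone_filter_right K fun u _ hu => (lt_of_lt_of_le hu hst).le
    · simp [hs, hst]
    · simp

theorem labCount_eq_card_filter_le {T Y : Type*} [LinearOrder T] [DecidableEq Y]
    (L : T → Y) (ℓ : Y) {k : ℕ} {K : Finset T} {t : T}
    (ht : (K.filter fun s => s ≤ t).card = k) :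
    labCount L k ℓ K = (K.filter fun s => s ≤ t ∧ L s = ℓ).card := by
  rw [labCount, nbhd_eq_filter_le ht, Finset.filter_filter]

/-- A finite set with at least `k ≥ 1` elements has a `k`-th smallest element. -/
theorem exists_mem_card_filter_le_eq {T : Type*} [LinearOrder T] {k : ℕ} (hk : 1 ≤ k)
    {K : Finset T} (hK : k ≤ K.card) : ∃ t ∈ K, (K.filter fun s => s ≤ t).card = k := by
  induction K using Finset.induction_on_max with
  | empty => simp at hK; omega
  | insert a K hmax ih =>
    have ha : a ∉ K := fun h => lt_irrefl a (hmax a h)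
    rw [Finset.card_insert_of_notMem ha] at hK
    rcases hK.lt_or_eq with hlt | heq
    · obtain ⟨t, htK, ht⟩ := ih (Nat.lt_succ_iff.mp hlt)
      refine ⟨t, Finset.mem_insert_of_mem htK, ?_⟩
      rwa [Finset.filter_insert, if_neg (hmax t htK).not_ge]
    · refine ⟨a, Finset.mem_insert_self a K, ?_⟩
      rw [Finset.filter_true_of_mem, Finset.card_insert_of_notMem ha, heq]
      intro s hs
      rcases Finset.mem_insert.mp hs with rfl | hs
      exacts [le_rfl, (hmax s hs).le]

theorem stmt13 {d : ℕ} {dom Y : Type*} [DecidableEq dom]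
    [LinearOrder (Fin d → dom)] [Fintype Y] [DecidableEq Y]
    (FDs : Set (Set (Fin d) × Set (Fin d)))
    (D : Finset (Fin d → dom)) (L : (Fin d → dom) → Y)
    (k : ℕ) (hk : 1 ≤ k)
    -- every repair has at least k tuples
    (hbig : ∀ I : Finset (Fin d → dom), IsFDRepair FDs D I → k ≤ I.card)
    (ℓ0 : Y)
    -- in some repair the k-NN classifier assigns the label ℓ0
    (hposs : ∃ I : Finset (Fin d → dom), IsFDRepair FDs D I ∧
      ∀ ℓ' : Y, ℓ' ≠ ℓ0 → labCount L k ℓ' I < labCount L k ℓ0 I) :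
    -- the test point is NOT certifiably robust
    (¬ ∃ ℓ : Y, ∀ I : Finset (Fin d → dom), IsFDRepair FDs D I →
        ∀ ℓ' : Y, ℓ' ≠ ℓ → labCount L k ℓ' I < labCount L k ℓ I) ↔
      -- iff there are a label ℓ ≠ ℓ0, a repair K and a threshold (the prefix of D
      -- up to some tuple t ∈ D) as described
      (∃ ℓ : Y, ℓ ≠ ℓ0 ∧ ∃ K : Finset (Fin d → dom), IsFDRepair FDs D K ∧
        ∃ t ∈ D,
          (K.filter fun s => s ≤ t).card = k ∧
          (K.filter fun s => s ≤ t ∧ L s = ℓ0).card ≤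
            (K.filter fun s => s ≤ t ∧ L s = ℓ).card) := by
  obtain ⟨I, hI, hI0⟩ := hposs
  constructor
  · intro hrob
    by_contra hno
    refine hrob ⟨ℓ0, fun K hK ℓ hℓ => ?_⟩
    obtain ⟨t, htK, ht⟩ := exists_mem_card_filter_le_eq hk (hbig K hK)
    by_contra hcount
    rw [labCount_eq_card_filter_le L ℓ ht, labCount_eq_card_filter_le L ℓ0 ht] at hcount
    exact hno ⟨ℓ, hℓ, K, hK, t, hK.1 htK, ht, not_lt.mp hcount⟩
  · rintro ⟨ℓ, hℓ, K, hK, t, -, ht, hcount⟩ ⟨ℓ1, hrob⟩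
    obtain rfl : ℓ1 = ℓ0 := by
      by_contra hne
      exact lt_asymm (hI0 ℓ1 hne) (hrob I hI ℓ0 (Ne.symm hne))
    have hlt := hrob K hK ℓ hℓ
    rw [labCount_eq_card_filter_le L ℓ ht, labCount_eq_card_filter_le L ℓ1 ht] at hlt
    exact hlt.not_ge hcount
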